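/- (J-IRL regret gap lower bound) There is a universal constant c > 0 such that for all integers u ≥ 3 and horizons H ≥ u, all β ∈ (0, 1/4], and all ε > 0 with ε·H ≤ β, there exist a finite Markov Game with horizon H, complete deviation classes Φ, an expert policy σ_E satisfying u-recoverability and β-coverage, and a learner policy σ with moment-matching error sup_{f∈F} (E_{π_{σ_E}}[(1/H) Σ_{h=1}^H f(s_h, a_h)] − E_{π_σ}[(1/H) Σ_{h=1}^H f(s_h, a_h)]) ≤ ε over the complete reward class F, such that the regret gap satisfies R_Φ(σ) − R_Φ(σ_E) ≥ c·(1/β)·ε·u·H. -/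

import Mathlib

open scoped Classical

noncomputable section

namespace MAIL

/-- A finite Markov Game: horizon `H`, transition kernel `T`, per-agent rewards `r`,
and initial state distribution `ρ₀`.  The agents are indexed by `Fin m`, the state
space is `S`, and agent `i` has action space `A i`; a joint action is an element of
`∀ i, A i`. -/
structure MG (m : ℕ) (S : Type) (A : Fin m → Type) where
  H : ℕ
  T : S → (∀ i, A i) → S → ℝ
  r : Fin m → S → (∀ i, A i) → ℝ
  ρ₀ : S → ℝ

variable {m : ℕ} {S : Type} {A : Fin m → Type} [Fintype S] [∀ i, Fintype (A i)]

/-- The Markov game data is valid: `ρ₀` and each `T s a` are probability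
distributions, and all rewards take values in `[-1, 1]`. -/
def IsMG (G : MG m S A) : Prop :=
  (∀ s, 0 ≤ G.ρ₀ s) ∧ (∑ s, G.ρ₀ s) = 1 ∧
  (∀ s a, (∀ s', 0 ≤ G.T s a s') ∧ (∑ s', G.T s a s') = 1) ∧
  (∀ i s a, |G.r i s a| ≤ 1)

/-- A (mediator or joint) policy is a stochastic map from states to joint actions.
When all agents obediently follow the mediator policy `σ`, the induced joint policy
`π_σ` is `σ` itself. -/
def IsPolicy (π : S → (∀ i, A i) → ℝ) : Prop :=
  ∀ s, (∀ a, 0 ≤ π s a) ∧ (∑ a, π s a) = 1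

/-- Distribution over states at (0-indexed) step `h` under joint policy `π`. -/
def stateDist (G : MG m S A) (π : S → (∀ i, A i) → ℝ) : ℕ → S → ℝ
  | 0 => G.ρ₀
  | h + 1 => fun s' => ∑ s, ∑ a, stateDist G π h s * π s a * G.T s a s'

/-- Expected cumulative reward over horizon `G.H` of joint policy `π` when every
agent's reward function is `f`, i.e. `J(π, f)`. -/
def Jf (G : MG m S A) (π : S → (∀ i, A i) → ℝ) (f : S → (∀ i, A i) → ℝ) : ℝ :=
  ∑ h ∈ Finset.range G.H, ∑ s, ∑ a, stateDist G π h s * π s a * f s a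

/-- Value `J_i(π)` of joint policy `π` for agent `i` under the true rewards. -/
def J (G : MG m S A) (i : Fin m) (π : S → (∀ i, A i) → ℝ) : ℝ :=
  Jf G π (G.r i)

/-- Occupancy measure `ρ^π(s, a) = (1/H) ∑_h Pr_π(s_h = s, a_h = a)`. -/
def occ (G : MG m S A) (π : S → (∀ i, A i) → ℝ) (s : S) (a : ∀ i, A i) : ℝ :=
  (∑ h ∈ Finset.range G.H, stateDist G π h s * π s a) / G.H

/-- Average state visitation distribution `d^π(s) = ∑_a ρ^π(s, a)`. -/
def dAvg (G : MG m S A) (π : S → (∀ i, A i) → ℝ) (s : S) : ℝ :=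
  ∑ a, occ G π s a

/-- The joint policy `π_{σ, φ_i}` obtained from mediator policy `σ` when agent `i`
deviates via `φ : S → A i → A i` (playing `φ s a` when recommended `a` at state `s`)
while all other agents follow their recommendations. -/
def dev (σ : S → (∀ i, A i) → ℝ) (i : Fin m) (φ : S → A i → A i) :
    S → (∀ i, A i) → ℝ :=
  fun s b => ∑ a : ∀ j, A j, if Function.update a i (φ s (a i)) = b then σ s a else 0

/-- Regret `R_Φ(σ, f)` of mediator policy `σ` w.r.t. deviation classes `Φ`, when
`f` is used as every agent's reward function. -/
def regretF (G : MG m S A) (σ : S → (∀ i, A i) → ℝ)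
    (Φ : ∀ i : Fin m, Set (S → A i → A i)) (f : S → (∀ i, A i) → ℝ) : ℝ :=
  ⨆ i : Fin m, ⨆ φ : Φ i, (Jf G (dev σ i φ.1) f - Jf G σ f)

/-- Regret `R_Φ(σ)` of mediator policy `σ` under the true rewards. -/
def regret (G : MG m S A) (σ : S → (∀ i, A i) → ℝ)
    (Φ : ∀ i : Fin m, Set (S → A i → A i)) : ℝ :=
  ⨆ i : Fin m, ⨆ φ : Φ i, (J G i (dev σ i φ.1) - J G i σ)

/-- Value-to-go `V` of joint policy `π` with `k` steps remaining (so the value from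
step `h` in the paper corresponds to `k = H - h` remaining steps), with every
agent's reward given by `f`. -/
def Vgo (G : MG m S A) (f : S → (∀ i, A i) → ℝ) (π : S → (∀ i, A i) → ℝ) :
    ℕ → S → ℝ
  | 0 => fun _ => 0
  | k + 1 => fun s => ∑ a, π s a * (f s a + ∑ s', G.T s a s' * Vgo G f π k s')

/-- Q-value of joint policy `π` with `k` steps remaining. -/
def Qgo (G : MG m S A) (f : S → (∀ i, A i) → ℝ) (π : S → (∀ i, A i) → ℝ)
    (k : ℕ) (s : S) (a : ∀ i, A i) : ℝ :=
  match k with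
  | 0 => 0
  | k + 1 => f s a + ∑ s', G.T s a s' * Vgo G f π k s'

/-- Advantage `A = Q - V` of joint policy `π` with `k` steps remaining. -/
def Adv (G : MG m S A) (f : S → (∀ i, A i) → ℝ) (π : S → (∀ i, A i) → ℝ)
    (k : ℕ) (s : S) (a : ∀ i, A i) : ℝ :=
  Qgo G f π k s a - Vgo G f π k s

/-- `u`-recoverability: the advantage of any expert-plus-single-deviation joint
policy `π_{σ_E, φ_i}` is bounded by `u` at every state, joint action, and step. -/
def Recoverable (G : MG m S A) (Φ : ∀ i : Fin m, Set (S → A i → A i))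
    (σE : S → (∀ i, A i) → ℝ) (u : ℝ) : Prop :=
  ∀ i : Fin m, ∀ φ ∈ Φ i, ∀ k ≤ G.H, ∀ s a, |Adv G (G.r i) (dev σE i φ) k s a| ≤ u

/-- `β`-coverage: the expert's average state distribution puts mass at least `β`
on every state. -/
def Coverage (G : MG m S A) (σE : S → (∀ i, A i) → ℝ) (β : ℝ) : Prop :=
  ∀ s, β ≤ dAvg G σE s

/-- Total variation distance between two finitely supported distributions. -/
def tv {α : Type} [Fintype α] (p q : α → ℝ) : ℝ :=
  (∑ a, |p a - q a|) / 2

section General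

variable {n : ℕ} {X : Type} {B : Fin n → Type} [∀ i, Fintype (B i)]

lemma sum_dev_mul (σ : X → (∀ i, B i) → ℝ) (i : Fin n) (φ : X → B i → B i)
    (s : X) (F : (∀ i, B i) → ℝ) :
    ∑ b, dev σ i φ s b * F b = ∑ a, σ s a * F (Function.update a i (φ s (a i))) := by
  simp only [dev, Finset.sum_mul]
  rw [Finset.sum_comm]
  refine Finset.sum_congr rfl fun a _ => ?_
  simp only [ite_mul, zero_mul, Finset.sum_ite_eq, Finset.mem_univ, if_true]

lemma IsPolicy.dev {σ : X → (∀ i, B i) → ℝ} (hσ : IsPolicy σ) (i : Fin n)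
    (φ : X → B i → B i) : IsPolicy (dev σ i φ) := by
  intro s
  refine ⟨fun b => Finset.sum_nonneg fun a _ => ?_, ?_⟩
  · split_ifs
    · exact (hσ s).1 a
    · exact le_rfl
  · have h := sum_dev_mul σ i φ s (fun _ => 1)
    simp only [mul_one] at h
    rw [h, (hσ s).2]

lemma stateDist_succ (G : MG m S A) (π : S → (∀ i, A i) → ℝ) (h : ℕ) (s' : S) :
    stateDist G π (h + 1) s' = ∑ s, stateDist G π h s * ∑ a, π s a * G.T s a s' := by
  simp only [stateDist, Finset.mul_sum, mul_assoc]

lemma Jf_eq (G : MG m S A) (π f : S → (∀ i, A i) → ℝ) :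
    Jf G π f = ∑ h ∈ Finset.range G.H, ∑ s, stateDist G π h s * ∑ a, π s a * f s a := by
  simp only [Jf, Finset.mul_sum, mul_assoc]

lemma stateDist_nonneg {G : MG m S A} (hG : IsMG G) {π : S → (∀ i, A i) → ℝ}
    (hπ : IsPolicy π) (h : ℕ) (s : S) : 0 ≤ stateDist G π h s := by
  induction h generalizing s with
  | zero => exact hG.1 s
  | succ h ih =>
    exact Finset.sum_nonneg fun t _ => Finset.sum_nonneg fun a _ =>
      mul_nonneg (mul_nonneg (ih t) ((hπ t).1 a)) ((hG.2.2.1 t a).1 s)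

lemma sum_stateDist {G : MG m S A} (hG : IsMG G) {π : S → (∀ i, A i) → ℝ}
    (hπ : IsPolicy π) (h : ℕ) : ∑ s, stateDist G π h s = 1 := by
  induction h with
  | zero => exact hG.2.1
  | succ h ih =>
    simp only [stateDist_succ]
    rw [Finset.sum_comm, ← ih]
    refine Finset.sum_congr rfl fun s _ => ?_
    rw [← Finset.mul_sum, Finset.sum_comm]
    simp only [← Finset.mul_sum, (hG.2.2.1 s _).2, mul_one, (hπ s).2]

end General

/-- Where the hard game moves when it does not resample its state: in state `0` the first
agent can move to state `1`, from where only both agents together can reach state `2`. -/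
def hardNext (s : Fin 3) (a : Fin 2 → Fin 2) : Fin 3 :=
  if s = 0 then (if a 0 = 1 then 1 else 0)
  else if s = 1 then (if a 0 = 1 ∧ a 1 = 1 then 2 else 1) else 2

/-- The resampling distribution of the hard game. -/
def hardInit (β : ℝ) : Fin 3 → ℝ := ![1 - 2 * β, β, β]

/-- A two-agent game which at each step resamples its state with probability `q`, and
otherwise moves by `hardNext`.  Only the first agent is rewarded, for being in state `2`. -/
def hardGame (H : ℕ) (q β : ℝ) : MG 2 (Fin 3) (fun _ => Fin 2) where
  H := H
  T s a s' := q * hardInit β s' + (1 - q) * if hardNext s a = s' then 1 else 0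
  r i s _ := if i = 0 ∧ s = 2 then 1 else 0
  ρ₀ := hardInit β

lemma hardGame_T (H : ℕ) (q β : ℝ) (s : Fin 3) (a : Fin 2 → Fin 2) (s' : Fin 3) :
    (hardGame H q β).T s a s' =
      q * hardInit β s' + (1 - q) * if hardNext s a = s' then 1 else 0 := rfl

/-- The mediator recommending `(0, 1)` with probability `p s` and `(0, 0)` otherwise. -/
def hardMediator (p : Fin 3 → ℝ) (s : Fin 3) (a : Fin 2 → Fin 2) : ℝ :=
  (if a = ![0, 0] then 1 - p s else 0) + if a = ![0, 1] then p s else 0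

lemma sum_hardMediator_mul (p : Fin 3 → ℝ) (s : Fin 3) (F : (Fin 2 → Fin 2) → ℝ) :
    ∑ a, hardMediator p s a * F a = (1 - p s) * F ![0, 0] + p s * F ![0, 1] := by
  simp only [hardMediator, add_mul, Finset.sum_add_distrib, ite_mul, zero_mul,
    Finset.sum_ite_eq', Finset.mem_univ, if_true]

lemma isPolicy_hardMediator {p : Fin 3 → ℝ} (h0 : ∀ s, 0 ≤ p s) (h1 : ∀ s, p s ≤ 1) :
    IsPolicy (A := fun _ : Fin 2 => Fin 2) (hardMediator p) := by
  intro s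
  refine ⟨fun a => ?_, ?_⟩
  · have := h0 s
    have := h1 s
    unfold hardMediator
    split_ifs <;> linarith
  · have h := sum_hardMediator_mul p s (fun _ => 1)
    simp only [mul_one] at h
    exact h.trans (by ring)

lemma sum_dev_hardMediator_mul (p : Fin 3 → ℝ) (φ : Fin 3 → Fin 2 → Fin 2) (s : Fin 3)
    (F : (Fin 2 → Fin 2) → ℝ) :
    ∑ b, dev (A := fun _ : Fin 2 => Fin 2) (hardMediator p) 0 φ s b * F b =
      (1 - p s) * F ![φ s 0, 0] + p s * F ![φ s 0, 1] := by
  have h := sum_dev_mul (B := fun _ : Fin 2 => Fin 2) (hardMediator p) 0 φ s F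
  rw [h]
  have h2 := sum_hardMediator_mul p s (fun a => F (Function.update a 0 (φ s (a 0))))
  refine h2.trans ?_
  have e (x y : Fin 2) : Function.update (![0, y] : Fin 2 → Fin 2) 0 x = ![x, y] := by
    ext i; fin_cases i <;> simp
  simp [e]

lemma sum_hardInit (β : ℝ) : ∑ s, hardInit β s = 1 := by
  simp [hardInit, Fin.sum_univ_three]; ring

lemma isMG_hardGame {H : ℕ} {q β : ℝ} (hq0 : 0 ≤ q) (hq1 : q ≤ 1) (hβ0 : 0 ≤ β)
    (hβ1 : β ≤ 1 / 4) : IsMG (hardGame H q β) := by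
  have hi : ∀ s, 0 ≤ hardInit β s := by
    intro s
    fin_cases s <;> simp [hardInit] <;> linarith
  refine ⟨hi, sum_hardInit β, fun s a => ⟨fun s' => ?_, ?_⟩, fun i s a => ?_⟩
  · refine add_nonneg (mul_nonneg hq0 (hi s')) (mul_nonneg (by linarith) ?_)
    split_ifs <;> norm_num
  · simp only [hardGame, Finset.sum_add_distrib, ← Finset.mul_sum, sum_hardInit,
      Finset.sum_ite_eq, Finset.mem_univ, if_true]
    ring
  · simp only [hardGame]
    split_ifs <;> norm_num

section Recoverability

variable {H : ℕ} {q β : ℝ}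

lemma Qgo_hardGame_succ (i : Fin 2) (π : Fin 3 → (Fin 2 → Fin 2) → ℝ) (k : ℕ) (s : Fin 3)
    (a : Fin 2 → Fin 2) :
    Qgo (hardGame H q β) ((hardGame H q β).r i) π (k + 1) s a =
      (if i = 0 ∧ s = 2 then 1 else 0) +
      q * ∑ s', hardInit β s' * Vgo (hardGame H q β) ((hardGame H q β).r i) π k s' +
      (1 - q) * Vgo (hardGame H q β) ((hardGame H q β).r i) π k (hardNext s a) := by
  simp only [Qgo]
  rw [show (hardGame H q β).r i s a = if i = 0 ∧ s = 2 then 1 else 0 from rfl, add_assoc]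
  congr 1
  simp only [hardGame, add_mul, Finset.sum_add_distrib, mul_assoc, ← Finset.mul_sum, ite_mul,
    one_mul, zero_mul, Finset.sum_ite_eq, Finset.mem_univ, if_true]

lemma Vgo_hardGame_succ (i : Fin 2) {π : Fin 3 → (Fin 2 → Fin 2) → ℝ}
    (hπ : IsPolicy (A := fun _ : Fin 2 => Fin 2) π) (k : ℕ) (s : Fin 3) :
    Vgo (hardGame H q β) ((hardGame H q β).r i) π (k + 1) s =
      (if i = 0 ∧ s = 2 then 1 else 0) +
      q * ∑ s', hardInit β s' * Vgo (hardGame H q β) ((hardGame H q β).r i) π k s' +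
      (1 - q) * ∑ a, π s a *
        Vgo (hardGame H q β) ((hardGame H q β).r i) π k (hardNext s a) := by
  have h : Vgo (hardGame H q β) ((hardGame H q β).r i) π (k + 1) s =
      ∑ a, π s a * Qgo (hardGame H q β) ((hardGame H q β).r i) π (k + 1) s a := rfl
  have h1 : ∑ a, π s a = 1 := (hπ s).2
  rw [h]
  simp only [Qgo_hardGame_succ]
  simp only [mul_add, Finset.sum_add_distrib, ← Finset.sum_mul, h1, one_mul]
  congr 1
  rw [Finset.mul_sum]
  exact Finset.sum_congr rfl fun a _ => by ring

lemma le_sum_mul_of_forall_le {α : Type} [Fintype α] {w v : α → ℝ} (h0 : ∀ a, 0 ≤ w a)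
    (h1 : ∑ a, w a = 1) {c : ℝ} (h : ∀ a, c ≤ v a) : c ≤ ∑ a, w a * v a := by
  calc c = ∑ a, w a * c := by rw [← Finset.sum_mul, h1, one_mul]
    _ ≤ _ := Finset.sum_le_sum fun a _ => mul_le_mul_of_nonneg_left (h a) (h0 a)

lemma sum_mul_le_of_forall_le {α : Type} [Fintype α] {w v : α → ℝ} (h0 : ∀ a, 0 ≤ w a)
    (h1 : ∑ a, w a = 1) {c : ℝ} (h : ∀ a, v a ≤ c) : ∑ a, w a * v a ≤ c := by
  calc _ ≤ ∑ a, w a * c :=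
        Finset.sum_le_sum fun a _ => mul_le_mul_of_nonneg_left (h a) (h0 a)
    _ = c := by rw [← Finset.sum_mul, h1, one_mul]

lemma exists_Vgo_hardGame_mem_Icc {u : ℝ} (hq1 : q ≤ 1) (hu : q * u = 1)
    (hu0 : 0 ≤ u) (i : Fin 2) {π : Fin 3 → (Fin 2 → Fin 2) → ℝ}
    (hπ : IsPolicy (A := fun _ : Fin 2 => Fin 2) π) (k : ℕ) :
    ∃ c, ∀ s, Vgo (hardGame H q β) ((hardGame H q β).r i) π k s ∈ Set.Icc c (c + u) := by
  induction k with
  | zero => exact ⟨0, fun s => ⟨le_rfl, by simpa [Vgo] using hu0⟩⟩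
  | succ k ih =>
    obtain ⟨c, hc⟩ := ih
    refine ⟨q * ∑ s', hardInit β s' *
      Vgo (hardGame H q β) ((hardGame H q β).r i) π k s' + (1 - q) * c, fun s => ?_⟩
    rw [Vgo_hardGame_succ i hπ]
    have l := mul_le_mul_of_nonneg_left (le_sum_mul_of_forall_le (hπ s).1 (hπ s).2
      fun a => (hc (hardNext s a)).1) (sub_nonneg.2 hq1)
    have r := mul_le_mul_of_nonneg_left (sum_mul_le_of_forall_le (hπ s).1 (hπ s).2
      fun a => (hc (hardNext s a)).2) (sub_nonneg.2 hq1)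
    have e : (1 - q) * (c + u) = (1 - q) * c + u - 1 := by linear_combination -hu
    constructor <;> split_ifs <;> linarith

lemma abs_Adv_hardGame_le {u : ℝ} (hq0 : 0 ≤ q) (hq1 : q ≤ 1) (hu : q * u = 1)
    (hu0 : 0 ≤ u) (i : Fin 2) {π : Fin 3 → (Fin 2 → Fin 2) → ℝ}
    (hπ : IsPolicy (A := fun _ : Fin 2 => Fin 2) π) (k : ℕ) (s : Fin 3)
    (a : Fin 2 → Fin 2) :
    |Adv (hardGame H q β) ((hardGame H q β).r i) π k s a| ≤ u := by
  cases k with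
  | zero => simpa [Adv, Qgo, Vgo] using hu0
  | succ k =>
    obtain ⟨c, hc⟩ := exists_Vgo_hardGame_mem_Icc (H := H) (β := β) hq1 hu hu0 i hπ k
    have l := le_sum_mul_of_forall_le (hπ s).1 (hπ s).2 fun a => (hc (hardNext s a)).1
    have r := sum_mul_le_of_forall_le (hπ s).1 (hπ s).2 fun a => (hc (hardNext s a)).2
    have ha := hc (hardNext s a)
    rw [Adv, Qgo_hardGame_succ, Vgo_hardGame_succ i hπ, add_sub_add_left_eq_sub, ← mul_sub,
      abs_mul, abs_of_nonneg (sub_nonneg.2 hq1)]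
    refine (mul_le_of_le_one_left (abs_nonneg _) (by linarith)).trans ?_
    rw [abs_le]
    constructor <;> linarith [ha.1, ha.2]

end Recoverability

section Occupancy

variable {H : ℕ} {q β : ℝ}

lemma stateDist_hardMediator (p : Fin 3 → ℝ) (h : ℕ) :
    stateDist (hardGame H q β) (hardMediator p) h = hardInit β := by
  induction h with
  | zero => rfl
  | succ h ih =>
    ext s'
    rw [stateDist_succ, ih]
    have hs (s : Fin 3) := sum_hardMediator_mul p s fun a => (hardGame H q β).T s a s'
    rw [Finset.sum_congr rfl fun s _ => congrArg (hardInit β s * ·) (hs s)]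
    simp only [hardGame, Fin.sum_univ_three]
    fin_cases s' <;> simp [hardNext, hardInit] <;> ring

lemma Jf_hardMediator (p : Fin 3 → ℝ) (f : Fin 3 → (Fin 2 → Fin 2) → ℝ) :
    Jf (hardGame H q β) (hardMediator p) f =
      H * ∑ s, hardInit β s * ((1 - p s) * f s ![0, 0] + p s * f s ![0, 1]) := by
  rw [Jf_eq]
  simp only [stateDist_hardMediator]
  have hs (s : Fin 3) := sum_hardMediator_mul p s (f s)
  rw [Finset.sum_congr rfl fun h _ => Finset.sum_congr rfl fun s _ =>
    congrArg (hardInit β s * ·) (hs s)]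
  simp [hardGame]

lemma J_hardGame_one (π : Fin 3 → (Fin 2 → Fin 2) → ℝ) : J (hardGame H q β) 1 π = 0 := by
  simp [J, Jf, hardGame]

lemma J_hardGame_zero {π : Fin 3 → (Fin 2 → Fin 2) → ℝ}
    (hπ : IsPolicy (A := fun _ : Fin 2 => Fin 2) π) :
    J (hardGame H q β) 0 π = ∑ h ∈ Finset.range H, stateDist (hardGame H q β) π h 2 := by
  have h1 : ∀ s, ∑ a, π s a = 1 := fun s => (hπ s).2
  rw [J, Jf_eq]
  refine Finset.sum_congr rfl fun h _ => ?_
  simp [hardGame, h1]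

lemma stateDist_dev_hardMediator_succ (p : Fin 3 → ℝ) (φ : Fin 3 → Fin 2 → Fin 2) (h : ℕ)
    (s' : Fin 3) :
    stateDist (hardGame H q β) (dev (hardMediator p) 0 φ) (h + 1) s' =
      ∑ s, stateDist (hardGame H q β) (dev (hardMediator p) 0 φ) h s *
        ((1 - p s) * (hardGame H q β).T s ![φ s 0, 0] s' +
          p s * (hardGame H q β).T s ![φ s 0, 1] s') := by
  rw [stateDist_succ]
  exact Finset.sum_congr rfl fun s _ => congrArg _
    (sum_dev_hardMediator_mul p φ s fun a => (hardGame H q β).T s a s')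

lemma stateDist_dev_hardMediator_zero_two (hG : IsMG (hardGame H q β))
    (φ : Fin 3 → Fin 2 → Fin 2) (h : ℕ) :
    stateDist (hardGame H q β) (dev (hardMediator 0) 0 φ) h 2 = β := by
  induction h with
  | zero => rfl
  | succ h ih =>
    have hsum := sum_stateDist hG ((isPolicy_hardMediator (p := 0) (fun _ => le_rfl)
      fun _ => zero_le_one).dev 0 φ) h
    rw [stateDist_dev_hardMediator_succ]
    rw [Fin.sum_univ_three] at hsum ⊢
    rw [ih] at hsum ⊢
    have e : hardNext 0 ![φ 0 0, 0] ≠ 2 := by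
      unfold hardNext
      rw [if_pos rfl]
      split_ifs <;> decide
    simp only [hardGame_T, if_neg e]
    simp [hardNext, hardInit]
    linear_combination q * β * hsum

variable {η : ℝ}

lemma stateDist_dev_one_succ_two (hG : IsMG (hardGame H q β)) (hη0 : 0 ≤ η) (hη1 : η ≤ 1)
    (h : ℕ) :
    stateDist (hardGame H q β) (dev (hardMediator ![0, η, 0]) 0 fun _ _ => 1) (h + 1) 2 =
      q * β + (1 - q) *
        (stateDist (hardGame H q β) (dev (hardMediator ![0, η, 0]) 0 fun _ _ => 1) h 2 +
        η * stateDist (hardGame H q β) (dev (hardMediator ![0, η, 0]) 0 fun _ _ => 1) h 1) := by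
  have hsum := sum_stateDist hG ((isPolicy_hardMediator (p := ![0, η, 0])
    (by intro s; fin_cases s <;> simp [hη0])
    (by intro s; fin_cases s <;> simp [hη1])).dev 0 fun _ _ => 1) h
  rw [stateDist_dev_hardMediator_succ]
  rw [Fin.sum_univ_three] at hsum ⊢
  simp [hardGame_T, hardNext, hardInit]
  linear_combination q * β * hsum

lemma stateDist_dev_one_succ_one (hG : IsMG (hardGame H q β)) (hη0 : 0 ≤ η) (hη1 : η ≤ 1)
    (h : ℕ) :
    stateDist (hardGame H q β) (dev (hardMediator ![0, η, 0]) 0 fun _ _ => 1) (h + 1) 1 =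
      q * β + (1 - q) * (1 -
        stateDist (hardGame H q β) (dev (hardMediator ![0, η, 0]) 0 fun _ _ => 1) h 2 -
        η * stateDist (hardGame H q β) (dev (hardMediator ![0, η, 0]) 0 fun _ _ => 1) h 1) := by
  have hsum := sum_stateDist hG ((isPolicy_hardMediator (p := ![0, η, 0])
    (by intro s; fin_cases s <;> simp [hη0])
    (by intro s; fin_cases s <;> simp [hη1])).dev 0 fun _ _ => 1) h
  rw [stateDist_dev_hardMediator_succ]
  rw [Fin.sum_univ_three] at hsum ⊢
  simp [hardGame_T, hardNext, hardInit]
  linear_combination (q * β + 1 - q) * hsum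

end Occupancy

/-- A recursion lower bound: the mass `g` accumulated in a state with return rate `q = 1 / u`,
fed at rate `η` by a state of mass `b`, exceeds its baseline by order `η * h * u / H`. -/
lemma lower_bound_of_recursion {u H : ℕ} (hu : 3 ≤ u) (hH : u ≤ H) {q β η : ℝ}
    (hq : q * u = 1) (hβ0 : 0 < β) (hβ : β ≤ 1 / 4) (hη0 : 0 ≤ η) (hη : η * H ≤ 1 / 2)
    {g b : ℕ → ℝ} (hb0 : ∀ h, 0 ≤ b h) (hb1 : ∀ h, b h ≤ 1) (hg0 : g 0 = β)
    (hg : ∀ h, g (h + 1) = q * β + (1 - q) * (g h + η * b h))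
    (hb : ∀ h, b (h + 1) = q * β + (1 - q) * (1 - g h - η * b h)) {h : ℕ} (hh : h + 1 ≤ H) :
    η / 18 * h * u / H ≤ g (h + 1) - β := by
  have hu' : (3 : ℝ) ≤ u := by exact_mod_cast hu
  have hH' : (u : ℝ) ≤ H := by exact_mod_cast hH
  have hH0 : (0 : ℝ) < H := by linarith
  have hq0 : 0 < q := by
    by_contra hn
    nlinarith
  have hq3 : q ≤ 1 / 3 := by nlinarith
  have hx (h) : 0 ≤ g h - β ∧ g h - β ≤ η * h := by
    induction h with
    | zero => simp [hg0]
    | succ h ih =>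
      have e : g (h + 1) - β = (1 - q) * (g h - β + η * b h) := by rw [hg]; ring
      have l := mul_nonneg hη0 (hb0 h)
      have r := mul_le_mul_of_nonneg_left (hb1 h) hη0
      rw [e]
      push_cast
      constructor <;> nlinarith [ih.1, ih.2]
  have hbl (h : ℕ) (hh : h + 1 ≤ H) : 1 / 6 ≤ b (h + 1) := by
    have r := mul_le_mul_of_nonneg_left (hb1 h) hη0
    have hc : η * ((h : ℝ) + 1) ≤ η * H :=
      mul_le_mul_of_nonneg_left (by exact_mod_cast hh) hη0
    have h4 : 1 / 4 ≤ 1 - g h - η * b h := by linarith [(hx h).2]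
    rw [hb]
    nlinarith [mul_pos hq0 hβ0]
  induction h with
  | zero => simpa using (hx 1).1
  | succ h ih =>
    have ih := ih (by omega)
    have e : g (h + 1 + 1) - β = (1 - q) * (g (h + 1) - β + η * b (h + 1)) := by
      rw [hg]; ring
    have l := mul_le_mul_of_nonneg_left (hbl h (by omega)) hη0
    have h1 : (1 - q) * (η / 18 * h * u / H + η * (1 / 6)) ≤ g (h + 1 + 1) - β := by
      rw [e]
      exact mul_le_mul_of_nonneg_left (by linarith) (by linarith)
    refine le_trans ?_ h1
    have h2 : (1 - q) * (η / 18 * h * u / H) =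
        η / 18 * h * u / H - η / 18 * (h / H) := by
      linear_combination -(η / 18 * h / H) * hq
    have h3 : (h : ℝ) / H ≤ 1 := by
      rw [div_le_one hH0]
      exact_mod_cast (by omega : h ≤ H)
    have h4 : (u : ℝ) / H ≤ 1 := by rwa [div_le_one hH0]
    have h5 : η / 18 * ((h + 1 : ℕ) : ℝ) * u / H =
        η / 18 * h * u / H + η / 18 * (u / H) := by
      push_cast; ring
    rw [h5, mul_add, h2]
    nlinarith

lemma sum_range_lower_bound {u H : ℕ} (hu : 3 ≤ u) (hH : u ≤ H) {η β : ℝ} (hη0 : 0 ≤ η)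
    {g : ℕ → ℝ} (hg0 : g 0 = β)
    (hg : ∀ h : ℕ, h + 1 ≤ H → η / 18 * h * u / H ≤ g (h + 1) - β) :
    η / 162 * u * H ≤ ∑ h ∈ Finset.range H, g h - H * β := by
  obtain ⟨n, rfl⟩ : ∃ n, H = n + 1 := ⟨H - 1, by omega⟩
  have hn : (2 : ℝ) ≤ n := by exact_mod_cast (by omega : 2 ≤ n)
  have hs : ∀ n : ℕ, ∑ h ∈ Finset.range n, (h : ℝ) = n * (n - 1) / 2 := by
    intro n
    induction n with
    | zero => simp
    | succ n ih => rw [Finset.sum_range_succ, ih]; push_cast; ring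
  have h1 : ∑ h ∈ Finset.range n, η / 18 * h * u / (n + 1 : ℕ) ≤
      ∑ h ∈ Finset.range n, (g (h + 1) - β) :=
    Finset.sum_le_sum fun h hh => hg h (by have := Finset.mem_range.1 hh; omega)
  have h2 : ∑ h ∈ Finset.range n, η / 18 * h * u / (n + 1 : ℕ) =
      η * u / 18 * ((n * (n - 1) / 2) / (n + 1)) := by
    rw [← hs, Finset.sum_div, Finset.mul_sum]
    refine Finset.sum_congr rfl fun h _ => ?_
    push_cast
    ring
  have h3 : ((n : ℝ) + 1) / 9 ≤ (n * (n - 1) / 2) / (n + 1) := by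
    rw [le_div_iff₀ (by linarith)]
    nlinarith
  have h4 := mul_le_mul_of_nonneg_left h3 (by positivity : 0 ≤ η * u / 18)
  rw [Finset.sum_range_succ', hg0]
  rw [h2, Finset.sum_sub_distrib] at h1
  simp only [Finset.sum_const, Finset.card_range, nsmul_eq_mul] at h1
  push_cast
  linarith

/-- **J-IRL regret gap lower bound.** There is a universal constant
`c > 0` such that for all integers `u ≥ 3`, horizons `H ≥ u`, all `β ∈ (0, 1/4]`,
and all `ε > 0` with `ε·H ≤ β`, there exist a finite Markov Game with horizon `H`,
complete deviation classes, an expert satisfying `u`-recoverability and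
`β`-coverage, and a learner whose moment-matching error over the complete reward
class is at most `ε`, whose regret gap is at least `c·(1/β)·ε·u·H`. -/
theorem jirl_regret_gap_lower_bound :
    ∃ c : ℝ, 0 < c ∧
      ∀ (u H : ℕ), 3 ≤ u → u ≤ H →
      ∀ β : ℝ, 0 < β → β ≤ 1 / 4 →
      ∀ ε : ℝ, 0 < ε → ε * H ≤ β →
      ∃ (m : ℕ) (_ : 0 < m) (nS : ℕ) (nA : Fin m → ℕ)
        (G : MG m (Fin nS) (fun i => Fin (nA i)))
        (Φ : ∀ i : Fin m, Set (Fin nS → Fin (nA i) → Fin (nA i)))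
        (σE σ : Fin nS → (∀ i, Fin (nA i)) → ℝ),
        IsMG G ∧ G.H = H ∧ (∀ i, Φ i = Set.univ) ∧
        IsPolicy σE ∧ IsPolicy σ ∧
        Recoverable G Φ σE (u : ℝ) ∧ Coverage G σE β ∧
        (∀ f : Fin nS → (∀ i, Fin (nA i)) → ℝ, (∀ s a, |f s a| ≤ 1) →
          Jf G σE f / H - Jf G σ f / H ≤ ε) ∧
        c * (1 / β) * ε * u * H ≤ regret G σ Φ - regret G σE Φ := by
  refine ⟨1 / 324, by norm_num, ?_⟩
  intro u H hu hH β hβ0 hβ ε hε hεH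
  have hu' : (3 : ℝ) ≤ u := by exact_mod_cast hu
  have hH' : (u : ℝ) ≤ H := by exact_mod_cast hH
  have hH0 : (0 : ℝ) < H := by linarith
  obtain ⟨q, hq⟩ : ∃ q : ℝ, q * u = 1 := ⟨(u : ℝ)⁻¹, inv_mul_cancel₀ (by linarith)⟩
  have hq0 : 0 ≤ q := by
    by_contra hn
    nlinarith
  have hq1 : q ≤ 1 := by nlinarith
  obtain ⟨η, hηdef⟩ : ∃ η, η = ε / (2 * β) := ⟨_, rfl⟩
  have hηβ : η * (2 * β) = ε := by
    rw [hηdef]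
    field_simp
  have hη0 : 0 ≤ η := by
    rw [hηdef]
    positivity
  have hηH : η * H ≤ 1 / 2 := by
    by_contra hn
    push Not at hn
    have := mul_lt_mul_of_pos_right hn (by linarith : 0 < 2 * β)
    nlinarith
  have hη1 : η ≤ 1 := by nlinarith
  have hG : IsMG (hardGame H q β) := isMG_hardGame hq0 hq1 hβ0.le hβ
  have hE : IsPolicy (A := fun _ : Fin 2 => Fin 2) (hardMediator 0) :=
    isPolicy_hardMediator (fun _ => le_rfl) fun _ => zero_le_one
  have hL : IsPolicy (A := fun _ : Fin 2 => Fin 2) (hardMediator ![0, η, 0]) :=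
    isPolicy_hardMediator (by intro s; fin_cases s <;> simp [hη0])
      (by intro s; fin_cases s <;> simp [hη1])
  have hJ {p : Fin 3 → ℝ} (hp : IsPolicy (A := fun _ : Fin 2 => Fin 2) (hardMediator p)) :
      J (hardGame H q β) 0 (hardMediator p) = H * β := by
    rw [J_hardGame_zero hp]
    simp [stateDist_hardMediator, hardInit]
  refine ⟨2, by norm_num, 3, fun _ => 2, hardGame H q β, fun _ => Set.univ, hardMediator 0,
    hardMediator ![0, η, 0], hG, rfl, fun _ => rfl, hE, hL, ?_, ?_, ?_, ?_⟩
  · intro i φ _ k _ s a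
    exact abs_Adv_hardGame_le hq0 hq1 hq (by linarith) i (hE.dev i φ) k s a
  · intro s
    have h1 : ∑ a, hardMediator 0 s a = 1 := (hE s).2
    have hd : dAvg (hardGame H q β) (hardMediator 0) s = hardInit β s := by
      simp only [dAvg, occ, stateDist_hardMediator, Finset.sum_const, Finset.card_range,
        nsmul_eq_mul]
      rw [← Finset.sum_div, ← Finset.mul_sum, ← Finset.mul_sum]
      refine (congrArg (fun x => (H : ℝ) * (hardInit β s * x) / H) h1).trans ?_
      field_simp
    rw [hd]
    fin_cases s <;> simp [hardInit]
    linarith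
  · intro f hf
    have hE' := Jf_hardMediator (H := H) (q := q) (β := β) 0 f
    have hL' := Jf_hardMediator (H := H) (q := q) (β := β) ![0, η, 0] f
    rw [hE', hL', mul_div_cancel_left₀ _ hH0.ne', mul_div_cancel_left₀ _ hH0.ne']
    simp only [Fin.sum_univ_three, hardInit]
    simp
    have h0 := abs_le.1 (hf 1 ![0, 0])
    have h1 := abs_le.1 (hf 1 ![0, 1])
    have h2 : f 1 ![0, 0] - f 1 ![0, 1] ≤ 2 := by linarith [h0.2, h1.1]
    have h3 := mul_le_mul_of_nonneg_left h2 (mul_nonneg hη0 hβ0.le)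
    linarith
  · have hRE : regret (hardGame H q β) (hardMediator 0) (fun _ => Set.univ) ≤ 0 := by
      refine ciSup_le fun i => ?_
      have : Nonempty (Set.univ : Set (Fin 3 → Fin 2 → Fin 2)) := ⟨⟨fun _ _ => 0, trivial⟩⟩
      refine ciSup_le fun φ => ?_
      fin_cases i
      · have h := J_hardGame_zero (H := H) (q := q) (β := β) (hE.dev 0 φ.1)
        simp only [stateDist_dev_hardMediator_zero_two hG, Finset.sum_const,
          Finset.card_range, nsmul_eq_mul] at h
        exact (sub_eq_zero.2 (h.trans (hJ hE).symm)).le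
      · exact (sub_eq_zero.2 ((J_hardGame_one _).trans (J_hardGame_one _).symm)).le
    have hRL : J (hardGame H q β) 0 (dev (hardMediator ![0, η, 0]) 0 fun _ _ => 1) -
        J (hardGame H q β) 0 (hardMediator ![0, η, 0]) ≤
        regret (hardGame H q β) (hardMediator ![0, η, 0]) (fun _ => Set.univ) := by
      refine le_trans ?_ (le_ciSup (Set.finite_range _).bddAbove (0 : Fin 2))
      exact le_ciSup (f := fun φ : (Set.univ : Set (Fin 3 → Fin 2 → Fin 2)) =>
        J (hardGame H q β) 0 (dev (hardMediator ![0, η, 0]) 0 φ.1) -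
          J (hardGame H q β) 0 (hardMediator ![0, η, 0]))
        (Set.finite_range _).bddAbove ⟨fun _ _ => 1, trivial⟩
    have hD := hL.dev 0 fun _ _ => 1
    have hD1 (h : ℕ) :
        stateDist (hardGame H q β) (dev (hardMediator ![0, η, 0]) 0 fun _ _ => 1) h 1 ≤ 1 := by
      rw [← sum_stateDist hG hD h]
      exact Finset.single_le_sum (fun s _ => stateDist_nonneg hG hD h s) (Finset.mem_univ 1)
    have key := sum_range_lower_bound hu hH hη0
      (g := fun h => stateDist (hardGame H q β)
        (dev (hardMediator ![0, η, 0]) 0 fun _ _ => 1) h 2) (β := β) rfl fun h hh =>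
      lower_bound_of_recursion hu hH hq hβ0 hβ hη0 hηH
        (fun h => stateDist_nonneg hG hD h 1) hD1 rfl
        (stateDist_dev_one_succ_two hG hη0 hη1) (stateDist_dev_one_succ_one hG hη0 hη1) hh
    rw [hJ hL, J_hardGame_zero hD] at hRL
    have hc : 1 / 324 * (1 / β) * ε * u * H = η / 162 * u * H := by
      rw [hηdef]
      field_simp
      norm_num
    rw [hc]
    linarith

end MAIL
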